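/- Let (X,ω) be a left Frobenius pair in an abelian category C. Then: (a) (X, ω^∧) is an X^∧-cotorsion pair in C; (b) the following equalities hold: ω^∧ = X^⊥ ∩ X^∧, ω = X ∩ ω^∧, and X = X^∧ ∩ ^⊥ω = X^∧ ∩ ^⊥(ω^∧). -/

import Mathlib

/-!
Common definitions for Auslander–Buchweitz approximation theory in abelian
categories, following Becerril–Mendoza–Pérez–Santiago.
-/

open CategoryTheory CategoryTheory.Limits ZeroObject

universe w v u

namespace ABFormal

variable {C : Type u} [Category.{v} C] [Abelian C] [CategoryTheory.HasExt.{w} C]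

/-- `0 → A → B → C' → 0` is a short exact sequence in `C`. -/
def IsShortExactSeq {A B C' : C} (f : A ⟶ B) (g : B ⟶ C') : Prop :=
  ∃ w : f ≫ g = 0, (ShortComplex.mk f g w).ShortExact

/-- `ωω` is `XX`-injective: `Ext^i(X, W) = 0` for all `X ∈ XX`, `W ∈ ωω` and `i > 0`. -/
def IsRelInjective (XX ωω : Set C) : Prop :=
  ∀ W ∈ ωω, ∀ X ∈ XX, ∀ i : ℕ, 0 < i → Subsingleton (Abelian.Ext.{w} X W i)

/-- `ωω` is `XX`-projective: `Ext^i(W, X) = 0` for all `X ∈ XX`, `W ∈ ωω` and `i > 0`. -/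
def IsRelProjective (XX ωω : Set C) : Prop :=
  ∀ W ∈ ωω, ∀ X ∈ XX, ∀ i : ℕ, 0 < i → Subsingleton (Abelian.Ext.{w} W X i)

/-- `ωω` is a relative cogenerator in `XX`. -/
def IsRelCogenerator (XX ωω : Set C) : Prop :=
  ωω ⊆ XX ∧ ∀ X ∈ XX, ∃ (W X' : C) (i : X ⟶ W) (p : W ⟶ X'),
    W ∈ ωω ∧ X' ∈ XX ∧ IsShortExactSeq i p

/-- `ωω` is a relative generator in `XX`. -/
def IsRelGenerator (XX ωω : Set C) : Prop :=
  ωω ⊆ XX ∧ ∀ X ∈ XX, ∃ (X' W : C) (i : X' ⟶ W) (p : W ⟶ X),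
    W ∈ ωω ∧ X' ∈ XX ∧ IsShortExactSeq i p

/-- `id_XX(M) ≤ n` : `Ext^j(X, M) = 0` for all `X ∈ XX` and `j > n`. -/
def relInjDimLE (XX : Set C) (M : C) (n : ℕ) : Prop :=
  ∀ X ∈ XX, ∀ j : ℕ, n < j → Subsingleton (Abelian.Ext.{w} X M j)

/-- The relative injective dimension `id_XX(M) : ℕ∞`. -/
noncomputable def relInjDim (XX : Set C) (M : C) : ℕ∞ :=
  sInf {m : ℕ∞ | ∃ n : ℕ, m = (n : ℕ∞) ∧ relInjDimLE XX M n}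

/-- `pd_XX(M) ≤ n` : `Ext^j(M, X) = 0` for all `X ∈ XX` and `j > n`. -/
def relProjDimLE (XX : Set C) (M : C) (n : ℕ) : Prop :=
  ∀ X ∈ XX, ∀ j : ℕ, n < j → Subsingleton (Abelian.Ext.{w} M X j)

/-- The relative projective dimension `pd_XX(M) : ℕ∞`. -/
noncomputable def relProjDim (XX : Set C) (M : C) : ℕ∞ :=
  sInf {m : ℕ∞ | ∃ n : ℕ, m = (n : ℕ∞) ∧ relProjDimLE XX M n}

/-- There is an exact sequence `0 → X_n → ⋯ → X_0 → M → 0` with all `X_i ∈ XX`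
(a resolution of length `n`). -/
inductive HasResolutionLength (XX : Set C) : ℕ → C → Prop
  | zero {M X : C} (hX : X ∈ XX) (e : X ≅ M) : HasResolutionLength XX 0 M
  | succ {n : ℕ} {M : C} (K X : C) (hX : X ∈ XX)
      (i : K ⟶ X) (p : X ⟶ M) (hse : IsShortExactSeq i p)
      (hK : HasResolutionLength XX n K) : HasResolutionLength XX (n + 1) M

/-- The `XX`-resolution dimension `resdim_XX(M) : ℕ∞`. -/
noncomputable def resDim (XX : Set C) (M : C) : ℕ∞ :=
  sInf {m : ℕ∞ | ∃ n : ℕ, m = (n : ℕ∞) ∧ HasResolutionLength XX n M}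

/-- `XX^∧`, the class of objects with a finite `XX`-resolution. -/
def resHat (XX : Set C) : Set C :=
  {M | ∃ n : ℕ, HasResolutionLength XX n M}

/-- There is an exact sequence `0 → M → X^0 → ⋯ → X^n → 0` with all `X^i ∈ XX`
(a coresolution of length `n`). -/
inductive HasCoresolutionLength (XX : Set C) : ℕ → C → Prop
  | zero {M X : C} (hX : X ∈ XX) (e : M ≅ X) : HasCoresolutionLength XX 0 M
  | succ {n : ℕ} {M : C} (X Q : C) (hX : X ∈ XX)
      (i : M ⟶ X) (p : X ⟶ Q) (hse : IsShortExactSeq i p)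
      (hQ : HasCoresolutionLength XX n Q) : HasCoresolutionLength XX (n + 1) M

/-- The `XX`-coresolution dimension `coresdim_XX(M) : ℕ∞`. -/
noncomputable def coresDim (XX : Set C) (M : C) : ℕ∞ :=
  sInf {m : ℕ∞ | ∃ n : ℕ, m = (n : ℕ∞) ∧ HasCoresolutionLength XX n M}

/-- `XX^∨`, the class of objects with a finite `XX`-coresolution. -/
def coresVee (XX : Set C) : Set C :=
  {M | ∃ n : ℕ, HasCoresolutionLength XX n M}

/-- `IsSyzygyOf XX n M K` : there is an exact sequence
`0 → K → X_{n-1} → ⋯ → X_0 → M → 0` with all `X_i ∈ XX`. -/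
inductive IsSyzygyOf (XX : Set C) : ℕ → C → C → Prop
  | zero {M K : C} (e : K ≅ M) : IsSyzygyOf XX 0 M K
  | succ {n : ℕ} {M : C} (K X L : C) (hX : X ∈ XX)
      (i : K ⟶ X) (p : X ⟶ L) (hse : IsShortExactSeq i p)
      (hL : IsSyzygyOf XX n M L) : IsSyzygyOf XX (n + 1) M K

/-- `XX^⊥ = {N | Ext^i(X, N) = 0 for all X ∈ XX, i > 0}`. -/
def rightPerp (XX : Set C) : Set C :=
  {N | ∀ X ∈ XX, ∀ i : ℕ, 0 < i → Subsingleton (Abelian.Ext.{w} X N i)}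

/-- `XX^{⊥₁} = {N | Ext^1(X, N) = 0 for all X ∈ XX}`. -/
def rightPerp1 (XX : Set C) : Set C :=
  {N | ∀ X ∈ XX, Subsingleton (Abelian.Ext.{w} X N 1)}

/-- `^⊥XX = {N | Ext^i(N, X) = 0 for all X ∈ XX, i > 0}`. -/
def leftPerp (XX : Set C) : Set C :=
  {N | ∀ X ∈ XX, ∀ i : ℕ, 0 < i → Subsingleton (Abelian.Ext.{w} N X i)}

/-- `^{⊥₁}XX = {N | Ext^1(N, X) = 0 for all X ∈ XX}`. -/
def leftPerp1 (XX : Set C) : Set C :=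
  {N | ∀ X ∈ XX, Subsingleton (Abelian.Ext.{w} N X 1)}

/-- Closed under extensions. -/
def ClosedUnderExtensions (XX : Set C) : Prop :=
  ∀ ⦃A B C' : C⦄ (f : A ⟶ B) (g : B ⟶ C'), IsShortExactSeq f g →
    A ∈ XX → C' ∈ XX → B ∈ XX

/-- Closed under kernels of epimorphisms between objects of the class. -/
def ClosedUnderKernelsOfEpis (XX : Set C) : Prop :=
  ∀ ⦃A B C' : C⦄ (f : A ⟶ B) (g : B ⟶ C'), IsShortExactSeq f g →
    B ∈ XX → C' ∈ XX → A ∈ XX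

/-- Closed under cokernels of monomorphisms between objects of the class. -/
def ClosedUnderCokernelsOfMonos (XX : Set C) : Prop :=
  ∀ ⦃A B C' : C⦄ (f : A ⟶ B) (g : B ⟶ C'), IsShortExactSeq f g →
    A ∈ XX → B ∈ XX → C' ∈ XX

/-- Closed under direct summands (retracts) in `C`. -/
def ClosedUnderSummands (XX : Set C) : Prop :=
  ∀ ⦃X A : C⦄, X ∈ XX → ∀ (s : A ⟶ X) (r : X ⟶ A), s ≫ r = 𝟙 A → A ∈ XX

/-- Pre-resolving class: closed under extensions and kernels of epimorphisms. -/
def IsPreresolving (XX : Set C) : Prop :=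
  ClosedUnderExtensions XX ∧ ClosedUnderKernelsOfEpis XX

/-- Pre-coresolving class: closed under extensions and cokernels of monomorphisms. -/
def IsPrecoresolving (XX : Set C) : Prop :=
  ClosedUnderExtensions XX ∧ ClosedUnderCokernelsOfMonos XX

/-- Left thick class. -/
def IsLeftThick (XX : Set C) : Prop :=
  IsPreresolving XX ∧ ClosedUnderSummands XX

/-- Right thick class. -/
def IsRightThick (XX : Set C) : Prop :=
  IsPrecoresolving XX ∧ ClosedUnderSummands XX

/-- Thick class. -/
def IsThickClass (XX : Set C) : Prop :=
  IsLeftThick XX ∧ IsRightThick XX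

/-- The smallest thick class of `C` containing `S`. -/
def thickClosure (S : Set C) : Set C :=
  ⋂₀ {T : Set C | IsThickClass T ∧ S ⊆ T}

/-- The class of projective objects of `C`. -/
def ProjClass (C : Type u) [Category.{v} C] : Set C := {P | Projective P}

/-- The class of injective objects of `C`. -/
def InjClass (C : Type u) [Category.{v} C] : Set C := {I | Injective I}

/-- Resolving class in `C`: pre-resolving and containing all projectives. -/
def IsResolvingClass (XX : Set C) : Prop :=
  IsPreresolving XX ∧ ProjClass C ⊆ XX

/-- Coresolving class in `C`: pre-coresolving and containing all injectives. -/
def IsCoresolvingClass (XX : Set C) : Prop :=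
  IsPrecoresolving XX ∧ InjClass C ⊆ XX

/-- A left Frobenius pair `(XX, ωω)` in `C`. -/
structure LeftFrobeniusPair (XX ωω : Set C) : Prop where
  leftThick : IsLeftThick XX
  relInj : IsRelInjective XX ωω
  relCogen : IsRelCogenerator XX ωω
  summands : ClosedUnderSummands ωω

/-- A strong left Frobenius pair `(XX, ωω)` in `C`. -/
structure StrongLeftFrobeniusPair (XX ωω : Set C) extends LeftFrobeniusPair XX ωω : Prop where
  relProj : IsRelProjective XX ωω
  relGen : IsRelGenerator XX ωω

/-- A right Frobenius pair `(νν, YY)` in `C`. -/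
structure RightFrobeniusPair (νν YY : Set C) : Prop where
  rightThick : IsRightThick YY
  relProj : IsRelProjective YY νν
  relGen : IsRelGenerator YY νν
  summands : ClosedUnderSummands νν

/-- `φ : X ⟶ M` is an `XX`-precover of `M`. -/
def IsPrecover (XX : Set C) {X M : C} (φ : X ⟶ M) : Prop :=
  X ∈ XX ∧ ∀ (X' : C), X' ∈ XX → ∀ f : X' ⟶ M, ∃ h : X' ⟶ X, h ≫ φ = f

/-- `φ : M ⟶ Y` is an `XX`-preenvelope of `M`. -/
def IsPreenvelope (XX : Set C) {M Y : C} (φ : M ⟶ Y) : Prop :=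
  Y ∈ XX ∧ ∀ (Y' : C), Y' ∈ XX → ∀ f : M ⟶ Y', ∃ h : Y ⟶ Y', φ ≫ h = f

/-- A left `S`-cotorsion pair `(F, G)` in `C`. -/
def IsLeftCotorsionPair (S F G : Set C) : Prop :=
  F ⊆ S ∧ G ⊆ S ∧
  F = {A | A ∈ S ∧ ∀ G' ∈ G, Subsingleton (Abelian.Ext.{w} A G' 1)} ∧
  ∀ s ∈ S, ∃ (G' F' : C) (i : G' ⟶ F') (p : F' ⟶ s),
    G' ∈ G ∧ F' ∈ F ∧ IsShortExactSeq i p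

/-- A right `S`-cotorsion pair `(F, G)` in `C`. -/
def IsRightCotorsionPair (S F G : Set C) : Prop :=
  F ⊆ S ∧ G ⊆ S ∧
  G = {A | A ∈ S ∧ ∀ F' ∈ F, Subsingleton (Abelian.Ext.{w} F' A 1)} ∧
  ∀ s ∈ S, ∃ (G' F' : C) (i : s ⟶ G') (p : G' ⟶ F'),
    G' ∈ G ∧ F' ∈ F ∧ IsShortExactSeq i p

/-- An `S`-cotorsion pair `(F, G)` in `C`. -/
def IsCotorsionPair (S F G : Set C) : Prop :=
  IsLeftCotorsionPair S F G ∧ IsRightCotorsionPair S F G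

/-- A left weak AB context `(AA, BB)` in `C`. -/
structure LeftWeakABContext (AA BB : Set C) : Prop where
  frob : LeftFrobeniusPair AA (AA ∩ BB)
  rightThick : IsRightThick BB
  sub : BB ⊆ resHat AA

/-- A class closed under summands is closed under isomorphisms. -/
theorem ClosedUnderSummands.mem_of_iso {C : Type u} [Category.{v} C] [Abelian C] {XX : Set C}
    (h : ClosedUnderSummands XX) {A B : C} (e : A ≅ B) (hA : A ∈ XX) : B ∈ XX :=
  h hA e.inv e.hom e.inv_hom_id

/-- The cokernel of a monomorphism is unchanged by pushout. -/
theorem IsShortExactSeq.pushout {C : Type u} [Category.{v} C] [Abelian C] {L X M H E : C}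
    {f : L ⟶ X} {g : X ⟶ M} (h : IsShortExactSeq f g) {a : L ⟶ H} {b : X ⟶ E} {f' : H ⟶ E}
    (sq : IsPushout f a b f') : ∃ q : E ⟶ M, b ≫ q = g ∧ IsShortExactSeq f' q := by
  obtain ⟨w, hS⟩ := h
  have : Mono f := hS.mono_f
  have : Epi g := hS.epi_g
  have : Mono f' := (MorphismProperty.monomorphisms C).of_isPushout sq.flip
    (MorphismProperty.monomorphisms.infer_property f)
  let q : E ⟶ M := sq.desc g 0 (by simpa using w)
  have hb : b ≫ q = g := sq.inl_desc _ _ _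
  have hf' : f' ≫ q = 0 := sq.inr_desc _ _ _
  have : Epi q := epi_of_epi_fac hb
  refine ⟨q, hb, hf', ShortComplex.ShortExact.mk ?_⟩
  refine ShortComplex.exact_of_g_is_cokernel _ (CokernelCofork.IsColimit.ofπ' q hf' fun k hk ↦
    ⟨hS.exact.desc (b ≫ k) ?_, ?_⟩)
  · simp [sq.w_assoc, hk]
  · apply sq.hom_ext
    · rw [reassoc_of% hb]
      exact hS.exact.g_desc _ _
    · rw [reassoc_of% hf', zero_comp, hk]

/-- Pushing out an epimorphism along a monomorphism keeps its kernel. -/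
theorem IsShortExactSeq.comp_of_isPushout {C : Type u} [Category.{v} C] [Abelian C]
    {H E M W Q : C} {f : H ⟶ E} {g : E ⟶ M} (h : IsShortExactSeq f g) {j : E ⟶ W} [Mono j]
    {b : W ⟶ Q} {m : M ⟶ Q} (sq : IsPushout j g b m) : IsShortExactSeq (f ≫ j) b := by
  obtain ⟨w, hS⟩ := h
  have : Mono f := hS.mono_f
  have : Epi g := hS.epi_g
  have : Epi b := (MorphismProperty.epimorphisms C).of_isPushout sq
    (MorphismProperty.epimorphisms.infer_property g)
  have w' : (f ≫ j) ≫ b = 0 := by rw [Category.assoc, sq.w, reassoc_of% w, zero_comp]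
  refine ⟨w', ShortComplex.ShortExact.mk ?_⟩
  refine ShortComplex.exact_of_g_is_cokernel _ (CokernelCofork.IsColimit.ofπ' b w' fun k hk ↦
    ⟨sq.desc k (hS.exact.desc (j ≫ k) ?_) ?_, sq.inl_desc _ _ _⟩)
  · simpa using hk
  · exact (hS.exact.g_desc _ _).symm

theorem IsShortExactSeq.exists_retraction {A B C' : C} {f : A ⟶ B} {g : B ⟶ C'}
    (h : IsShortExactSeq f g) (hE : Subsingleton (Abelian.Ext.{w} C' A 1)) :
    ∃ r : B ⟶ A, f ≫ r = 𝟙 A := by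
  obtain ⟨w, hS⟩ := h
  obtain ⟨x, hx⟩ := Abelian.Ext.contravariant_sequence_exact₁ hS A (Abelian.Ext.mk₀ (𝟙 A))
    (add_zero 1) (hE.elim _ _)
  obtain ⟨r, rfl⟩ := Abelian.Ext.addEquiv₀.symm.surjective x
  exact ⟨r, Abelian.Ext.addEquiv₀.symm.injective (by simpa using hx)⟩

theorem IsShortExactSeq.exists_section {A B C' : C} {f : A ⟶ B} {g : B ⟶ C'}
    (h : IsShortExactSeq f g) (hE : Subsingleton (Abelian.Ext.{w} C' A 1)) :
    ∃ s : C' ⟶ B, s ≫ g = 𝟙 C' := by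
  obtain ⟨w, hS⟩ := h
  obtain ⟨x, hx⟩ := Abelian.Ext.covariant_sequence_exact₃ C' hS (Abelian.Ext.mk₀ (𝟙 C'))
    (zero_add 1) (hE.elim _ _)
  obtain ⟨r, rfl⟩ := Abelian.Ext.addEquiv₀.symm.surjective x
  exact ⟨r, Abelian.Ext.addEquiv₀.symm.injective (by simpa using hx)⟩

theorem IsShortExactSeq.subsingleton_ext_mid {A B C' : C} {f : A ⟶ B} {g : B ⟶ C'}
    (h : IsShortExactSeq f g) {Y : C} {n : ℕ} (hA : Subsingleton (Abelian.Ext.{w} Y A n))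
    (hC : Subsingleton (Abelian.Ext.{w} Y C' n)) : Subsingleton (Abelian.Ext.{w} Y B n) := by
  obtain ⟨w, hS⟩ := h
  refine subsingleton_of_forall_eq 0 fun x ↦ ?_
  obtain ⟨y, rfl⟩ := Abelian.Ext.covariant_sequence_exact₂ Y hS x (hC.elim _ _)
  rw [hA.elim y 0, Abelian.Ext.zero_comp]

theorem IsShortExactSeq.subsingleton_ext_right {A B C' : C} {f : A ⟶ B} {g : B ⟶ C'}
    (h : IsShortExactSeq f g) {Y : C} {n : ℕ} (hB : Subsingleton (Abelian.Ext.{w} Y B n))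
    (hA : Subsingleton (Abelian.Ext.{w} Y A (n + 1))) :
    Subsingleton (Abelian.Ext.{w} Y C' n) := by
  obtain ⟨w, hS⟩ := h
  refine subsingleton_of_forall_eq 0 fun x ↦ ?_
  obtain ⟨y, rfl⟩ := Abelian.Ext.covariant_sequence_exact₃ Y hS x rfl (hA.elim _ _)
  rw [hB.elim y 0, Abelian.Ext.zero_comp]

theorem subset_resHat {C : Type u} [Category.{v} C] [Abelian C] (XX : Set C) :
    XX ⊆ resHat XX := fun _ hX ↦ ⟨0, .zero hX (Iso.refl _)⟩

theorem resHat_mono {C : Type u} [Category.{v} C] [Abelian C] {XX YY : Set C} (h : XX ⊆ YY) :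
    resHat XX ⊆ resHat YY := by
  rintro M ⟨n, hn⟩
  refine ⟨n, ?_⟩
  induction hn with
  | zero hX e => exact .zero (h hX) e
  | succ K X hX i p hse _ ih => exact .succ K X (h hX) i p hse ih

theorem mem_resHat_of_ses {C : Type u} [Category.{v} C] [Abelian C] {XX : Set C} {K X M : C}
    {i : K ⟶ X} {p : X ⟶ M} (h : IsShortExactSeq i p) (hK : K ∈ resHat XX) (hX : X ∈ XX) :
    M ∈ resHat XX :=
  hK.imp' Nat.succ fun _ hn ↦ .succ K X hX i p h hn

theorem leftPerp_subset_leftPerp_resHat {ωω : Set C} (hω : ClosedUnderSummands ωω) :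
    leftPerp.{w} ωω ⊆ leftPerp.{w} (resHat ωω) := by
  rintro A hA M ⟨n, hn⟩
  induction hn with
  | zero hX e => exact hA _ (hω.mem_of_iso e hX)
  | succ K X hX i p hse _ ih =>
    exact fun j hj ↦ hse.subsingleton_ext_right (hA _ hX j hj) (ih _ j.succ_pos)

namespace LeftFrobeniusPair

variable {XX ωω : Set C} (hfrob : LeftFrobeniusPair.{w} XX ωω)
include hfrob

/-- The Auslander–Buchweitz approximation sequences. -/
theorem exists_approximations {M : C} (hM : M ∈ resHat XX) :
    (∃ (K X : C) (i : K ⟶ X) (p : X ⟶ M),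
      K ∈ resHat ωω ∧ X ∈ XX ∧ IsShortExactSeq i p) ∧
    ∃ (H X : C) (i : M ⟶ H) (p : H ⟶ X),
      H ∈ resHat ωω ∧ X ∈ XX ∧ IsShortExactSeq i p := by
  obtain ⟨n, hn⟩ := hM
  induction hn with
  | @zero M X hX e =>
    have hM := hfrob.leftThick.2.mem_of_iso e hX
    obtain ⟨W, X', i, p, hW, hX', hse⟩ := hfrob.relCogen.2 M hM
    have h0 : (0 : C) ∈ ωω := hfrob.summands hW 0 0 (by simp)
    refine ⟨⟨0, M, 0, 𝟙 M, subset_resHat _ h0, hM, by simp, ShortComplex.ShortExact.mk ?_⟩,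
      W, X', i, p, subset_resHat _ hW, hX', hse⟩
    exact (ShortComplex.exact_iff_mono _ rfl).2 (inferInstanceAs (Mono (𝟙 M)))
  | @succ n M L X₀ hX₀ i p hse _ ih =>
    obtain ⟨H, X', a, c, hH, hX', hse'⟩ := ih.2
    have sq := IsPushout.of_hasPushout i a
    obtain ⟨q, -, hq⟩ := hse.pushout sq
    obtain ⟨r, -, hr⟩ := hse'.pushout sq.flip
    have hE := hfrob.leftThick.1.1 _ _ hr hX₀ hX'
    refine ⟨⟨H, _, _, q, hH, hE, hq⟩, ?_⟩
    obtain ⟨W, X'', j, s, hW, hX'', hj⟩ := hfrob.relCogen.2 _ hE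
    have sq' := IsPushout.of_hasPushout j q
    obtain ⟨t, -, ht⟩ := hj.pushout sq'
    have : Mono j := hj.choose_spec.mono_f
    exact ⟨_, X'', _, t, mem_resHat_of_ses (hq.comp_of_isPushout sq') hH hW, hX'', ht⟩

theorem subset_leftPerp : XX ⊆ leftPerp.{w} ωω :=
  fun X hX W hW ↦ hfrob.relInj W hW X hX

theorem subset_leftPerp_resHat : XX ⊆ leftPerp.{w} (resHat ωω) :=
  hfrob.subset_leftPerp.trans (leftPerp_subset_leftPerp_resHat hfrob.summands)

theorem inter_rightPerp1_subset : XX ∩ rightPerp1.{w} XX ⊆ ωω := by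
  rintro X ⟨hX, hperp⟩
  obtain ⟨W, X', i, p, hW, hX', hse⟩ := hfrob.relCogen.2 X hX
  obtain ⟨r, hr⟩ := hse.exists_retraction (hperp _ hX')
  exact hfrob.summands hW i r hr

theorem resHat_inter_rightPerp1_subset : resHat XX ∩ rightPerp1.{w} XX ⊆ resHat ωω := by
  rintro M ⟨hM, hM'⟩
  obtain ⟨K, X, i, p, hK, hX, hse⟩ := (hfrob.exists_approximations hM).1
  refine mem_resHat_of_ses hse hK (hfrob.inter_rightPerp1_subset ⟨hX, fun Y hY ↦ ?_⟩)
  exact hse.subsingleton_ext_mid (hfrob.subset_leftPerp_resHat hY K hK 1 one_pos) (hM' Y hY)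

theorem resHat_inter_leftPerp1_subset : resHat XX ∩ leftPerp1.{w} (resHat ωω) ⊆ XX := by
  rintro M ⟨hM, hM'⟩
  obtain ⟨K, X, i, p, hK, hX, hse⟩ := (hfrob.exists_approximations hM).1
  obtain ⟨s, hs⟩ := hse.exists_section (hM' K hK)
  exact hfrob.leftThick.2 hX s p hs

end LeftFrobeniusPair

/-- Theorem CP2. Let `(X,ω)` be a left Frobenius pair. Then (a)
`(X, ω^∧)` is an `X^∧`-cotorsion pair; (b) `ω^∧ = X^⊥ ∩ X^∧`, `ω = X ∩ ω^∧`, and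
`X = X^∧ ∩ ^⊥ω = X^∧ ∩ ^⊥(ω^∧)`. -/
theorem stmt13 (XX ωω : Set C) (hfrob : LeftFrobeniusPair XX ωω) :
    IsCotorsionPair (resHat XX) XX (resHat ωω) ∧
    resHat ωω = rightPerp XX ∩ resHat XX ∧
    ωω = XX ∩ resHat ωω ∧
    XX = resHat XX ∩ leftPerp ωω ∧
    XX = resHat XX ∩ leftPerp (resHat ωω) := by
  have hsub : resHat ωω ⊆ resHat XX := resHat_mono hfrob.relCogen.1
  have hperp := hfrob.subset_leftPerp_resHat
  refine ⟨⟨⟨subset_resHat XX, hsub, ?_, fun M hM ↦ (hfrob.exists_approximations hM).1⟩,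
    subset_resHat XX, hsub, ?_, fun M hM ↦ (hfrob.exists_approximations hM).2⟩, ?_, ?_, ?_, ?_⟩
  · exact Set.Subset.antisymm
      (fun X hX ↦ ⟨subset_resHat XX hX, fun H hH ↦ hperp hX H hH 1 one_pos⟩)
      hfrob.resHat_inter_leftPerp1_subset
  · exact Set.Subset.antisymm (fun H hH ↦ ⟨hsub hH, fun X hX ↦ hperp hX H hH 1 one_pos⟩)
      hfrob.resHat_inter_rightPerp1_subset
  · exact Set.Subset.antisymm (fun H hH ↦ ⟨fun X hX ↦ hperp hX H hH, hsub hH⟩)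
      fun M hM ↦ hfrob.resHat_inter_rightPerp1_subset
        ⟨hM.2, fun X hX ↦ hM.1 X hX 1 one_pos⟩
  · exact Set.Subset.antisymm (fun W hW ↦ ⟨hfrob.relCogen.1 hW, subset_resHat ωω hW⟩)
      fun M hM ↦ hfrob.inter_rightPerp1_subset
        ⟨hM.1, fun X hX ↦ hperp hX M hM.2 1 one_pos⟩
  · exact Set.Subset.antisymm (fun X hX ↦ ⟨subset_resHat XX hX, hfrob.subset_leftPerp hX⟩)
      fun M hM ↦ hfrob.resHat_inter_leftPerp1_subset
        ⟨hM.1, fun H hH ↦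
          leftPerp_subset_leftPerp_resHat hfrob.summands hM.2 H hH 1 one_pos⟩
  · exact Set.Subset.antisymm (fun X hX ↦ ⟨subset_resHat XX hX, hperp hX⟩)
      fun M hM ↦ hfrob.resHat_inter_leftPerp1_subset
        ⟨hM.1, fun H hH ↦ hM.2 H hH 1 one_pos⟩

end ABFormal
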